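/- The set of (natural-number encodings of) aTAM tile assembly systems 𝒯 = (T, σ, τ) for which some location of the seed assembly σ blocks a tile in one or more valid assembly sequences of 𝒯 is not computable; that is, there is no total computable function deciding, given an encoding of an arbitrary aTAM system, whether some seed location can block. -/

import Mathlib

namespace ATAM

/-- A tile type: a glue label (a natural number, with `0` the null glue) on each
of its four sides (north, east, south, west). -/
structure TileType where
  north : ℕ
  east : ℕ
  south : ℕ
  west : ℕ
deriving DecidableEq

/-- An assembly: a partial function from ℤ² to tile types. -/
abbrev Assembly := ℤ × ℤ → Option TileType

/-- The domain of an assembly. -/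
def adom (α : Assembly) : Set (ℤ × ℤ) := {p | α p ≠ none}

/-- `α` is a subassembly of `β` (written `α ⊑ β` in the paper). -/
def Subassembly (α β : Assembly) : Prop := ∀ p t, α p = some t → β p = some t

/-- Place tile `t` at position `p`. -/
def place (α : Assembly) (p : ℤ × ℤ) (t : TileType) : Assembly :=
  fun q => if q = p then some t else α q

/-- Remove the tile (if any) at position `p`. -/
def unplace (α : Assembly) (p : ℤ × ℤ) : Assembly :=
  fun q => if q = p then none else α q

/-- Union of two assemblies (preferring the left one where both are defined). -/
def aunion (α β : Assembly) : Assembly := fun p => (α p).orElse fun _ => β p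

/-- Two positions are adjacent iff they are at Manhattan distance 1. -/
def Adjacent (p q : ℤ × ℤ) : Prop := (p.1 - q.1).natAbs + (p.2 - q.2).natAbs = 1

/-- The total strength with which a tile of type `t` placed at (empty) position
`p` would bind to the assembly `α` (glues on abutting sides must match). -/
def attachStrength (str : ℕ → ℕ) (α : Assembly) (p : ℤ × ℤ) (t : TileType) : ℕ :=
  (match α (p.1, p.2 + 1) with
    | some u => if t.north = u.south then str t.north else 0
    | none => 0) +
  (match α (p.1 + 1, p.2) with
    | some u => if t.east = u.west then str t.east else 0
    | none => 0) +
  (match α (p.1, p.2 - 1) with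
    | some u => if t.south = u.north then str t.south else 0
    | none => 0) +
  (match α (p.1 - 1, p.2) with
    | some u => if t.west = u.east then str t.west else 0
    | none => 0)

/-- The strength of the bond between the tiles of `α` at `p` and at `q`
(nonzero only when `q` is one of the four neighbors of `p` and the glue labels
on the abutting sides match). -/
def interactionStrength (str : ℕ → ℕ) (α : Assembly) (p q : ℤ × ℤ) : ℕ :=
  match α p, α q with
  | some t, some u =>
      if q = (p.1, p.2 + 1) then (if t.north = u.south then str t.north else 0)
      else if q = (p.1 + 1, p.2) then (if t.east = u.west then str t.east else 0)
      else if q = (p.1, p.2 - 1) then (if t.south = u.north then str t.south else 0)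
      else if q = (p.1 - 1, p.2) then (if t.west = u.east then str t.west else 0)
      else 0
  | _, _ => 0

/-- The total strength of the cut `(A, B)` of the binding graph of `α`
(each crossing bond is counted exactly once, since `interactionStrength` is
directional and the two matching glues have equal strength). -/
def cutStrength (str : ℕ → ℕ) (α : Assembly) (A B : Finset (ℤ × ℤ)) : ℕ :=
  ∑ p ∈ A, ∑ q ∈ B, interactionStrength str α p q

/-- `α` is `τ`-stable: every cut of its binding graph has strength at least `τ`. -/
def IsStable (str : ℕ → ℕ) (τ : ℕ) (α : Assembly) : Prop :=
  ∀ A B : Finset (ℤ × ℤ), (A : Set (ℤ × ℤ)) ∪ (B : Set (ℤ × ℤ)) = adom α →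
    Disjoint A B → A.Nonempty → B.Nonempty → τ ≤ cutStrength str α A B

/-- A tile assembly system (TAS): a finite tile set, a glue strength function,
a seed assembly and a temperature. -/
structure TAS where
  tiles : Finset TileType
  str : ℕ → ℕ
  seed : Assembly
  temp : ℕ

/-- Well-formedness of a TAS: the null glue has strength 0, the temperature is
at least 1, and the seed is finite, over the tile set, and `τ`-stable. -/
def WellFormed (𝒯 : TAS) : Prop :=
  𝒯.str 0 = 0 ∧ 1 ≤ 𝒯.temp ∧ (adom 𝒯.seed).Finite ∧
    (∀ p t, 𝒯.seed p = some t → t ∈ 𝒯.tiles) ∧ IsStable 𝒯.str 𝒯.temp 𝒯.seed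

/-- A single tile attachment step of `𝒯`. -/
def Step (𝒯 : TAS) (α β : Assembly) : Prop :=
  ∃ p t, t ∈ 𝒯.tiles ∧ α p = none ∧ 𝒯.temp ≤ attachStrength 𝒯.str α p t ∧ β = place α p t

/-- A (finite or infinite) assembly sequence of `𝒯`, presented as an ℕ-indexed
sequence that starts at the seed and in which each assembly is obtained from the
previous one by a single attachment (or is unchanged, to accommodate finite
sequences). -/
def IsSeq (𝒯 : TAS) (f : ℕ → Assembly) : Prop :=
  f 0 = 𝒯.seed ∧ ∀ n, Step 𝒯 (f n) (f (n + 1)) ∨ f (n + 1) = f n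

/-- `α` is producible in `𝒯`: it is the result (limit) of an assembly sequence. -/
def Producible (𝒯 : TAS) (α : Assembly) : Prop :=
  ∃ f : ℕ → Assembly, IsSeq 𝒯 f ∧ ∀ p t, α p = some t ↔ ∃ n, f n p = some t

/-- `β` is producible from `α` by the attachment of zero or more tiles
(`α →^𝒯 β`). -/
def ProducibleFrom (𝒯 : TAS) (α β : Assembly) : Prop :=
  Relation.ReflTransGen (Step 𝒯) α β

/-- `α` is terminal: no tile can attach to it. -/
def Terminal (𝒯 : TAS) (α : Assembly) : Prop :=
  ∀ p t, t ∈ 𝒯.tiles → α p = none → attachStrength 𝒯.str α p t < 𝒯.temp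

/-- `𝒯` self-assembles the shape `S`: every producible terminal assembly has
domain `S`, and there is at least one producible terminal assembly. -/
def SelfAssembles (𝒯 : TAS) (S : Set (ℤ × ℤ)) : Prop :=
  (∀ α, Producible 𝒯 α → Terminal 𝒯 α → adom α = S) ∧
    ∃ α, Producible 𝒯 α ∧ Terminal 𝒯 α

/-- `S ⊆ ℤ²` is connected w.r.t. adjacency at Manhattan distance 1. -/
def ConnectedIn (S : Set (ℤ × ℤ)) : Prop :=
  ∀ p ∈ S, ∀ q ∈ S, Relation.ReflTransGen (fun a b => a ∈ S ∧ b ∈ S ∧ Adjacent a b) p q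

end ATAM
namespace ATAM

def TileType.equivProd : TileType ≃ ℕ × ℕ × ℕ × ℕ where
  toFun t := (t.north, t.east, t.south, t.west)
  invFun p := ⟨p.1, p.2.1, p.2.2.1, p.2.2.2⟩
  left_inv t := rfl
  right_inv p := rfl

instance : Encodable TileType := Encodable.ofEquiv _ TileType.equivProd

/-- A finite description of a TAS: a finite tile set, a finite table of glue
strengths, a finite table of seed tile placements, and a temperature. -/
abbrev Desc := Finset TileType × List (ℕ × ℕ) × List ((ℤ × ℤ) × TileType) × ℕ

/-- The TAS described by a description. -/
def toTAS (d : Desc) : TAS where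
  tiles := d.1
  str := fun g => (d.2.1.lookup g).getD 0
  seed := fun p => d.2.2.1.lookup p
  temp := d.2.2.2

end ATAM
namespace ATAM

/-- Some location `ℓ` of the seed of `𝒯` blocks a tile in one or more valid
assembly sequences: there is a producible assembly `α` with a tile `t` at `ℓ`,
and a valid growth from `α` that places a tile adjacent to `ℓ` which did not
require the glues of `t` to bind, and to which a tile of a type different from
`t` could bind with strength `τ` at `ℓ` if `t` were removed. -/
def SeedBlocks (𝒯 : TAS) : Prop :=
  ∃ ℓ ∈ adom 𝒯.seed, ∃ α, Producible 𝒯 α ∧ ∃ t, α ℓ = some t ∧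
    ∃ β q u, ProducibleFrom 𝒯 α β ∧ Adjacent q ℓ ∧ β q = none ∧ u ∈ 𝒯.tiles ∧
      𝒯.temp ≤ attachStrength 𝒯.str (unplace β ℓ) q u ∧
      ∃ δ, ProducibleFrom 𝒯 (place β q u) δ ∧
        ∃ t', t' ∈ 𝒯.tiles ∧ t' ≠ t ∧ 𝒯.temp ≤ attachStrength 𝒯.str (unplace δ ℓ) ℓ t'

section Machine

open Turing

/-- The partial function that decodes `2 ^ m` into the code with number `m` and runs it on `0`. -/
def evalLog (n : ℕ) : Part ℕ :=
  (Nat.rfind fun k => Part.some (decide (2 ^ k = n))).bind fun m =>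
    Nat.Partrec.Code.eval (Denumerable.ofNat Nat.Partrec.Code m) 0

theorem primrec_two_pow : Primrec fun k : ℕ => 2 ^ k := by
  have h : Primrec fun k : ℕ => Nat.rec (motive := fun _ => ℕ) 1 (fun _ r => 2 * r) k :=
    Primrec.nat_rec₁ 1 ((Primrec.nat_mul.comp (Primrec.const 2) Primrec.snd).to₂)
  refine h.of_eq fun k => ?_
  induction k with
  | zero => rfl
  | succ k ih => rw [pow_succ', ← ih]

theorem partrec_evalLog : Partrec evalLog := by
  refine Partrec.bind (Partrec.rfind (p := fun n k => Part.some (decide (2 ^ k = n))) ?_) ?_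
  · have h : PrimrecPred fun x : ℕ × ℕ => 2 ^ x.2 = x.1 :=
      Primrec.eq.comp (primrec_two_pow.comp Primrec.snd) Primrec.fst
    exact h.decide.to_comp.partrec
  · exact (Nat.Partrec.Code.eval_part.comp
      ((Computable.ofNat Nat.Partrec.Code).comp Computable.snd) (Computable.const 0))

theorem evalLog_two_pow (m : ℕ) :
    evalLog (2 ^ m) = Nat.Partrec.Code.eval (Denumerable.ofNat Nat.Partrec.Code m) 0 := by
  have h : (Nat.rfind fun k => Part.some (decide (2 ^ k = 2 ^ m))) = Part.some m := by
    refine Part.eq_some_iff.2 (Nat.mem_rfind.2 ⟨by simp, fun {k} hk => ?_⟩)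
    simp only [Part.mem_some_iff]
    symm
    simpa using hk.ne
  rw [evalLog, h, Part.bind_some]

theorem not_computable_evalLog : ¬ ComputablePred fun m : ℕ => (evalLog (2 ^ m)).Dom := by
  intro h
  refine ComputablePred.halting_problem 0 (ComputablePred.computable_of_manyOneReducible
    ⟨Encodable.encode, Computable.encode, fun c => ?_⟩ h)
  simp [evalLog_two_pow]

theorem trNat_two_pow (m : ℕ) :
    PartrecToTM2.trNat (2 ^ m) =
      List.replicate m PartrecToTM2.Γ'.bit0 ++ [PartrecToTM2.Γ'.bit1] := by
  have h : ∀ m : ℕ, ∃ p : PosNum, ((2 ^ m : ℕ) : Num) = Num.pos p ∧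
      PartrecToTM2.trPosNum p =
        List.replicate m PartrecToTM2.Γ'.bit0 ++ [PartrecToTM2.Γ'.bit1] := by
    intro m
    induction m with
    | zero => exact ⟨PosNum.one, by simp; rfl, rfl⟩
    | succ m ih =>
      obtain ⟨p, hp, hp'⟩ := ih
      refine ⟨p.bit0, ?_, by simp [PartrecToTM2.trPosNum, hp', List.replicate_succ]⟩
      rw [pow_succ, mul_two, Nat.cast_add, hp]
      exact Num.bit0_of_bit0 (Num.pos p)
  obtain ⟨p, hp, hp'⟩ := h m
  rw [PartrecToTM2.trNat, hp]
  exact hp'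

instance : Finite PartrecToTM2.K' :=
  Finite.of_surjective
    (fun i : Fin 4 => match i with
      | 0 => PartrecToTM2.K'.main
      | 1 => PartrecToTM2.K'.rev
      | 2 => PartrecToTM2.K'.aux
      | 3 => PartrecToTM2.K'.stack)
    (by rintro (_ | _ | _ | _) <;> [exact ⟨0, rfl⟩; exact ⟨1, rfl⟩; exact ⟨2, rfl⟩; exact ⟨3, rfl⟩])

/-- There is a fixed finite Turing machine whose halting on inputs of the form `c₀ c₁ c₂ᵐ` is an
undecidable property of `m`. -/
theorem exists_undecidable_machine :
    ∃ (Γ Λ : Type) (_ : Inhabited Γ) (_ : Inhabited Λ) (_ : Finite Γ) (M : TM0.Machine Γ Λ)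
      (S : Set Λ) (c₀ c₁ c₂ : Γ), S.Finite ∧ TM0.Supports M S ∧
      ¬ ComputablePred fun m : ℕ =>
        (TM0.eval M (c₀ :: c₁ :: List.replicate m c₂)).Dom := by
  classical
  have hf : @Nat.Partrec' 1 (fun v => evalLog v.head) :=
    Nat.Partrec'.part_iff₁.2 partrec_evalLog
  obtain ⟨c, hc⟩ := ToPartrec.Code.exists_code hf
  let iΛ : Inhabited PartrecToTM2.Λ' :=
    ⟨PartrecToTM2.trNormal c PartrecToTM2.Cont'.halt⟩
  let _ : Fintype PartrecToTM2.K' := Fintype.ofFinite _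
  let M₂ : PartrecToTM2.Λ' → TM2.Stmt (fun _ : PartrecToTM2.K' => PartrecToTM2.Γ')
    PartrecToTM2.Λ' (Option PartrecToTM2.Γ') := PartrecToTM2.tr
  let M₁ := TM2to1.tr M₂
  let S₁ := TM2to1.trSupp M₂ (PartrecToTM2.codeSupp c PartrecToTM2.Cont'.halt)
  let up : PartrecToTM2.Γ' →
      TM2to1.Γ' PartrecToTM2.K' (fun _ : PartrecToTM2.K' => PartrecToTM2.Γ') :=
    fun a => (false, Function.update (fun _ => none) PartrecToTM2.K'.main (some a))
  refine ⟨TM2to1.Γ' PartrecToTM2.K' (fun _ => PartrecToTM2.Γ'), TM1to0.Λ' M₁,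
    inferInstance, inferInstance, inferInstance, TM1to0.tr M₁, ↑(TM1to0.trStmts M₁ S₁),
    (true, (up PartrecToTM2.Γ'.cons).2), up PartrecToTM2.Γ'.bit1, up PartrecToTM2.Γ'.bit0,
    Finset.finite_toSet _, ?_, ?_⟩
  · have h₂ : TM2.Supports M₂ (PartrecToTM2.codeSupp c PartrecToTM2.Cont'.halt) :=
      PartrecToTM2.tr_supports c _
    exact TM1to0.tr_supports M₁ (TM2to1.tr_supports M₂ h₂)
  · intro h
    refine not_computable_evalLog (h.of_eq fun m => ?_)
    have hin : (true, (up PartrecToTM2.Γ'.cons).2) :: up PartrecToTM2.Γ'.bit1 ::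
        List.replicate m (up PartrecToTM2.Γ'.bit0) =
        TM2to1.trInit PartrecToTM2.K'.main (PartrecToTM2.trList [2 ^ m]) := by
      have hl : (PartrecToTM2.trList [2 ^ m]).reverse = PartrecToTM2.Γ'.cons ::
          PartrecToTM2.Γ'.bit1 :: List.replicate m PartrecToTM2.Γ'.bit0 := by
        simp [PartrecToTM2.trList, trNat_two_pow]
      unfold TM2to1.trInit
      rw [hl]
      exact congrArg (fun l => _ :: _ :: l) List.map_replicate.symm
    refine (iff_of_eq (congrArg (fun l => (TM0.eval (TM1to0.tr M₁) l).Dom) hin)).trans ?_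
    rw [TM1to0.tr_eval]
    refine (TM2to1.tr_eval_dom M₂ PartrecToTM2.K'.main _).trans ?_
    have hinit : (TM2.init PartrecToTM2.K'.main (PartrecToTM2.trList [2 ^ m]) :
        TM2.Cfg (fun _ : PartrecToTM2.K' => PartrecToTM2.Γ') PartrecToTM2.Λ'
          (Option PartrecToTM2.Γ')) = PartrecToTM2.init c [2 ^ m] := by
      unfold TM2.init PartrecToTM2.init
      congr 1
      funext k
      cases k <;> rfl
    have he := PartrecToTM2.tr_eval c [2 ^ m]
    have hc' := hc ⟨[2 ^ m], rfl⟩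
    have hd : (TM2.eval M₂ PartrecToTM2.K'.main (PartrecToTM2.trList [2 ^ m])).Dom ↔
        (StateTransition.eval (TM2.step M₂) (PartrecToTM2.init c [2 ^ m])).Dom := by
      rw [TM2.eval, hinit]
      rfl
    rw [hd]
    change (StateTransition.eval (TM2.step PartrecToTM2.tr) _).Dom ↔ _
    rw [he]
    change (ToPartrec.Code.eval c [2 ^ m]).Dom ↔ _
    rw [hc']
    rfl

end Machine

section Automaton

open Turing

theorem exists_undecidable_finite_machine :
    ∃ (Γ Λ : Type) (_ : Inhabited Γ) (_ : Inhabited Λ) (_ : Finite Γ) (_ : Finite Λ)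
      (M : TM0.Machine Γ Λ) (c₀ c₁ c₂ : Γ),
      ¬ ComputablePred fun m : ℕ =>
        (StateTransition.eval (TM0.step M)
          (TM0.init (c₀ :: c₁ :: List.replicate m c₂))).Dom := by
  classical
  obtain ⟨Γ, Λ, iΓ, iΛ, fΓ, M, S, c₀, c₁, c₂, hS, hM, h⟩ := exists_undecidable_machine
  let _ : Inhabited S := ⟨⟨default, hM.1⟩⟩
  let i : PointedMap Γ Γ := ⟨id, rfl⟩
  let g₁ : PointedMap Λ S :=
    ⟨fun q => if hq : q ∈ S then ⟨q, hq⟩ else default, dif_pos hM.1⟩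
  refine ⟨Γ, S, iΓ, inferInstance, fΓ, hS.to_subtype, M.map i i g₁ Subtype.val, c₀, c₁, c₂,
    fun h' => h (h'.of_eq fun m => ?_)⟩
  have hr := TM0.Machine.map_respects M i i g₁ Subtype.val hM (fun _ => rfl)
    (fun q hq => by
      change ((if hq : q ∈ S then (⟨q, hq⟩ : S) else default : S) : Λ) = q
      rw [dif_pos hq])
  have hi := TM0.map_init (Γ := Γ) (Γ' := Γ) i g₁ (c₀ :: c₁ :: List.replicate m c₂)
  have hl : (c₀ :: c₁ :: List.replicate m c₂).map i = c₀ :: c₁ :: List.replicate m c₂ :=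
    List.map_id _
  rw [hl] at hi
  exact StateTransition.tr_eval_dom hr ⟨hM.1, hi⟩

/-- The space-time diagram of the one-way cellular automaton with local rule `g`, where the new
content of a cell depends on that cell and the two cells to its left. -/
def caRow {A : Type} (g : A → A → A → A) (r : ℤ → A) : ℕ → ℤ → A
  | 0, x => r x
  | t + 1, x => g (caRow g r t (x - 2)) (caRow g r t (x - 1)) (caRow g r t x)

/-- The initial row that holds `u v wᵐ`, starting in position `1`, on a background of `b`. -/
def inputRow {A : Type} (b u v w : A) (m : ℕ) (x : ℤ) : A :=
  if x = 1 then u else if x = 2 then v else if 3 ≤ x ∧ x < m + 3 then w else b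

section Simulation

variable {Γ Λ : Type} [Inhabited Γ] [Inhabited Λ] (M : TM0.Machine Γ Λ)

/-- The instruction executed at a cell, if the head is there. -/
def cellAct (c : Γ × Option Λ) : Option (Λ × TM0.Stmt Γ) := c.2.bind fun q => M q c.1

/-- The local rule that simulates `M`. -/
def cellStep (l c r : Γ × Option Λ) : Γ × Option Λ :=
  (match cellAct M c with
    | some (_, TM0.Stmt.write a) => a
    | _ => c.1,
   match cellAct M c, cellAct M l, cellAct M r with
    | some (q, TM0.Stmt.write _), _, _ => some q
    | _, some (q, TM0.Stmt.move Dir.right), _ => some q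
    | _, _, some (q, TM0.Stmt.move Dir.left) => some q
    | _, _, _ => none)

/-- The head is at this cell and the machine halts. -/
def CellHalts (c : Γ × Option Λ) : Prop := ∃ q, c.2 = some q ∧ M q c.1 = none

/-- The row `r` represents the configuration `c` with the head at position `h`. -/
def Represents (r : ℤ → Γ × Option Λ) (c : TM0.Cfg Γ Λ) (h : ℤ) : Prop :=
  ∀ x, r x = (c.Tape.nth (x - h), if x = h then some c.q else none)

theorem Represents.step {M : TM0.Machine Γ Λ} {r : ℤ → Γ × Option Λ} {c c' : TM0.Cfg Γ Λ} {h : ℤ}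
    (hr : Represents r c h) (hc : c' ∈ TM0.step M c) :
    ∃ h', Represents (fun x => cellStep M (r (x - 2)) (r (x - 1)) (r x)) c' h' := by
  obtain ⟨q, T⟩ := c
  have hact : ∀ x, cellAct M (r x) = if x = h then M q T.head else none := by
    intro x
    rw [hr x, cellAct]
    by_cases hx : x = h
    · subst hx; simp
    · simp [hx]
  have hfst : ∀ x, (r x).1 = T.nth (x - h) := fun x => by rw [hr x]
  obtain ⟨⟨q', s⟩, hM, rfl⟩ := Option.map_eq_some_iff.1 hc
  simp only [hM] at hact
  rcases s with (_ | _) | a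
  · refine ⟨h, fun x => ?_⟩
    simp only [cellStep, hact, hfst (x - 1), Tape.move_left_nth]
    rw [show x - 1 - h = x - h - 1 by ring]
    by_cases h1 : x - 1 = h
    · have h2 : ¬ x - 2 = h := by omega
      have h3 : ¬ x = h := by omega
      simp [h1, h2, h3]
    · by_cases h2 : x - 2 = h
      · have h3 : ¬ x = h := by omega
        simp [h1, h2, h3]
      · by_cases h3 : x = h <;> simp [h1, h2, h3]
  · refine ⟨h + 2, fun x => ?_⟩
    simp only [cellStep, hact, hfst (x - 1), Tape.move_right_nth]
    rw [show x - (h + 2) + 1 = x - 1 - h by ring]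
    by_cases h1 : x - 1 = h
    · have h2 : ¬ x - 2 = h := by omega
      have h3 : ¬ x = h := by omega
      have h4 : ¬ x = h + 2 := by omega
      simp [h1, h2, h3, h4]
    · by_cases h2 : x - 2 = h
      · have h3 : ¬ x = h := by omega
        have h4 : x = h + 2 := by omega
        simp [h4]
      · have h4 : ¬ x = h + 2 := by omega
        by_cases h3 : x = h
        · simp [h3]
        · simp [h1, h2, h3, h4]
  · refine ⟨h + 1, fun x => ?_⟩
    simp only [cellStep, hact, hfst (x - 1), Tape.write_nth]
    rw [show x - (h + 1) = x - 1 - h by ring]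
    by_cases h1 : x - 1 = h
    · have h4 : x = h + 1 := by omega
      simp [h4]
    · have h4 : ¬ x = h + 1 := by omega
      have h5 : ¬ x - 1 - h = 0 := by omega
      by_cases h2 : x - 2 = h <;> by_cases h3 : x = h <;> simp [h1, h2, h3, h4, h5]

theorem Represents.cellHalts_iff {r : ℤ → Γ × Option Λ} {c : TM0.Cfg Γ Λ} {h : ℤ}
    (hr : Represents r c h) : (∃ x, CellHalts M (r x)) ↔ TM0.step M c = none := by
  obtain ⟨q, T⟩ := c
  have hs : TM0.step M ⟨q, T⟩ = none ↔ M q T.head = none := Option.map_eq_none_iff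
  rw [hs]
  constructor
  · rintro ⟨x, q', h1, h2⟩
    rw [hr x] at h1 h2
    by_cases hx : x = h
    · subst hx
      simp only [if_true, Option.some.injEq] at h1
      simpa [h1] using h2
    · simp [hx] at h1
  · intro h1
    exact ⟨h, q, by rw [hr h]; simp, by rw [hr h]; simpa using h1⟩

theorem Represents.dom_iff {r : ℤ → Γ × Option Λ} {c : TM0.Cfg Γ Λ} {h : ℤ}
    (hr : Represents r c h) :
    (StateTransition.eval (TM0.step M) c).Dom ↔
      ∃ t x, CellHalts M (caRow (cellStep M) r t x) := by
  constructor
  · intro hd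
    obtain ⟨hc, hn⟩ := StateTransition.mem_eval.1 (Part.get_mem hd)
    generalize (StateTransition.eval (TM0.step M) c).get hd = c' at hc hn
    have : ∃ t h', Represents (caRow (cellStep M) r t) c' h' := by
      clear hn
      induction hc with
      | refl => exact ⟨0, h, hr⟩
      | tail _ hs ih =>
        obtain ⟨t, h', ht⟩ := ih
        exact ⟨t + 1, ht.step hs⟩
    obtain ⟨t, h', ht⟩ := this
    exact ⟨t, (ht.cellHalts_iff M).2 hn⟩
  · rintro ⟨t, x, hx⟩
    by_contra hd
    have : ∀ t, ∃ c' h', StateTransition.Reaches (TM0.step M) c c' ∧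
        Represents (caRow (cellStep M) r t) c' h' := by
      intro t
      induction t with
      | zero => exact ⟨c, h, Relation.ReflTransGen.refl, hr⟩
      | succ t ih =>
        obtain ⟨c', h', hc, ht⟩ := ih
        rcases hs : TM0.step M c' with _ | c''
        · exact absurd (Part.dom_iff_mem.2 ⟨c', StateTransition.mem_eval.2 ⟨hc, hs⟩⟩) hd
        · obtain ⟨h'', ht'⟩ := ht.step hs
          exact ⟨c'', h'', hc.tail hs, ht'⟩
    obtain ⟨c', h', hc, ht⟩ := this t
    exact hd (Part.dom_iff_mem.2
      ⟨c', StateTransition.mem_eval.2 ⟨hc, (ht.cellHalts_iff M).1 ⟨x, hx⟩⟩⟩)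

theorem represents_init (c₀ c₁ c₂ : Γ) (m : ℕ) :
    Represents (inputRow (default, none) (c₀, some default) (c₁, none) (c₂, none) m)
      (TM0.init (Λ := Λ) (c₀ :: c₁ :: List.replicate m c₂)) 1 := by
  intro x
  rcases lt_or_ge x 1 with hx | hx
  · obtain ⟨n, rfl⟩ : ∃ n : ℕ, x = -n := ⟨(-x).toNat, by omega⟩
    have h1 : ¬ -(n : ℤ) = 1 := by omega
    have h2 : ¬ -(n : ℤ) = 2 := by omega
    have h3 : ¬ (3 ≤ -(n : ℤ) ∧ -(n : ℤ) < m + 3) := by omega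
    have h4 : -(n : ℤ) - 1 = Int.negSucc n := by rw [Int.negSucc_eq]; ring
    rw [inputRow, if_neg h1, if_neg h2, if_neg h3, if_neg h1, h4]
    refine Prod.ext ?_ rfl
    change default = (ListBlank.mk ([] : List Γ)).nth n
    simp
  · obtain ⟨n, rfl⟩ : ∃ n : ℕ, x = n + 1 := ⟨(x - 1).toNat, by omega⟩
    have h4 : (TM0.init (Λ := Λ) (c₀ :: c₁ :: List.replicate m c₂)).Tape.nth ((n : ℤ) + 1 - 1) =
        (c₀ :: c₁ :: List.replicate m c₂).getI n := by
      rw [add_sub_cancel_right, ← ListBlank.nth_mk]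
      exact Tape.mk'_nth_nat _ _ n
    rw [h4, inputRow]
    rcases n with _ | _ | n
    · simp
      rfl
    · simp [List.getI]
    · have h1 : ¬ ((n + 1 + 1 : ℕ) : ℤ) + 1 = 1 := by omega
      have h2 : ¬ ((n + 1 + 1 : ℕ) : ℤ) + 1 = 2 := by omega
      rw [if_neg h1, if_neg h2, if_neg h1]
      by_cases hn : n < m
      · rw [if_pos (by omega)]
        simp [List.getI, List.getD, hn]
      · rw [if_neg (by omega)]
        simp [List.getI, List.getD, hn]

end Simulation

/-- There is a fixed one-way cellular automaton for which it is undecidable whether the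
evolution of the row `u v wᵐ` contains a cell in a distinguished set of cell states. -/
theorem exists_undecidable_automaton :
    ∃ (A : Type) (_ : Finite A) (b u v w : A) (g : A → A → A → A) (H : A → Prop),
      g b b b = b ∧ ¬ H b ∧
      ¬ ComputablePred fun m : ℕ => ∃ t x, H (caRow g (inputRow b u v w m) t x) := by
  obtain ⟨Γ, Λ, _, _, _, _, M, c₀, c₁, c₂, h⟩ := exists_undecidable_finite_machine
  refine ⟨Γ × Option Λ, inferInstance, (default, none), (c₀, some default), (c₁, none), (c₂, none),
    cellStep M, CellHalts M, rfl, ?_, fun h' => h (h'.of_eq fun m => ?_)⟩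
  · rintro ⟨q, h1, -⟩
    cases h1
  · exact ((represents_init c₀ c₁ c₂ m).dom_iff M).symm

end Automaton

section Tiles

/-- A one-way cellular automaton with an injective numbering of its finitely many cell states. -/
structure CellAutomaton (A : Type) where
  /-- the background state -/
  b : A
  /-- the first input state -/
  u : A
  /-- the second input state -/
  v : A
  /-- the repeated input state -/
  w : A
  /-- the local rule -/
  g : A → A → A → A
  /-- the halting states -/
  H : A → Prop
  /-- the numbering of the states -/
  code : A → ℕ
  /-- a bound for the glue labels -/
  bound : ℕ
  quiescent : g b b b = b
  not_halt : ¬ H b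
  code_injective : Function.Injective code
  pair_lt : ∀ p q, 6 + 2 * Nat.pair (code p) (code q) < bound

/-- The strength with which glue `g` binds to the glue `o` of an optional neighbor. -/
def sideStrength (str : ℕ → ℕ) (g : ℕ) (o : Option ℕ) : ℕ := if o = some g then str g else 0

theorem sideStrength_none (str : ℕ → ℕ) (g : ℕ) : sideStrength str g none = 0 := by
  simp [sideStrength]

theorem sideStrength_self (str : ℕ → ℕ) (g : ℕ) : sideStrength str g (some g) = str g := by
  simp [sideStrength]

theorem attachStrength_eq (str : ℕ → ℕ) (α : Assembly) (x y : ℤ) (t : TileType) :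
    attachStrength str α (x, y) t =
      sideStrength str t.north ((α (x, y + 1)).map TileType.south) +
      sideStrength str t.east ((α (x + 1, y)).map TileType.west) +
      sideStrength str t.south ((α (x, y - 1)).map TileType.north) +
      sideStrength str t.west ((α (x - 1, y)).map TileType.east) := by
  unfold attachStrength sideStrength
  congr 1
  · congr 1
    · congr 1
      · rcases α (x, y + 1) with _ | u <;> simp [eq_comm]
      · rcases α (x + 1, y) with _ | u <;> simp [eq_comm]
    · rcases α (x, y - 1) with _ | u <;> simp [eq_comm]
  · rcases α (x - 1, y) with _ | u <;> simp [eq_comm]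

/-- The strength of the glue with label `k`. -/
def glueStrength (k : ℕ) : ℕ := if k = 0 then 0 else if k ≤ 4 then 2 else 1

theorem lookup_map_of_injOn {ι κ β : Type} [BEq κ] [LawfulBEq κ] (l : List ι) (k : ι → κ)
    (f : ι → β) (hk : Function.Injective k) (i : ι) (hi : i ∈ l) :
    (l.map fun j => (k j, f j)).lookup (k i) = some (f i) := by
  induction l with
  | nil => simp at hi
  | cons j l ih =>
    rw [List.map_cons, List.lookup_cons]
    by_cases h : k i = k j
    · obtain rfl := hk h
      simp
    · have hb : (k i == k j) = false := by simpa using h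
      rw [hb]
      rcases List.mem_cons.1 hi with rfl | hi
      · exact absurd rfl h
      · exact ih hi

theorem lookup_map_eq_none {ι κ β : Type} [BEq κ] [LawfulBEq κ] (l : List ι) (k : ι → κ)
    (f : ι → β) (p : κ) (hp : ∀ i ∈ l, p ≠ k i) :
    (l.map fun j => (k j, f j)).lookup p = none := by
  rw [List.lookup_eq_none_iff]
  intro q hq
  obtain ⟨i, hi, rfl⟩ := List.mem_map.1 hq
  simpa using hp i hi

namespace CellAutomaton

variable {A : Type} (K : CellAutomaton A)

/-- The row at time `t` of the evolution on input `m`. -/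
def row (m : ℕ) : ℕ → ℤ → A := caRow K.g (inputRow K.b K.u K.v K.w m)

theorem row_nonpos (m t : ℕ) (x : ℤ) (hx : x ≤ 0) : K.row m t x = K.b := by
  induction t generalizing x with
  | zero =>
    change inputRow K.b K.u K.v K.w m x = K.b
    rw [inputRow, if_neg (by omega), if_neg (by omega), if_neg (by omega)]
  | succ t ih =>
    change K.g (K.row m t (x - 2)) (K.row m t (x - 1)) (K.row m t x) = K.b
    rw [ih _ (by omega), ih _ (by omega), ih _ hx, K.quiescent]

/-- The glue that transmits the state `a` upwards. -/
def vGlue (a : A) : ℕ := 5 + 2 * K.code a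

/-- The glue that transmits the states `p` and `q` to the right. -/
def hGlue (p q : A) : ℕ := 6 + 2 * Nat.pair (K.code p) (K.code q)

theorem vGlue_inj {a c : A} : K.vGlue a = K.vGlue c ↔ a = c :=
  ⟨fun h => K.code_injective (by unfold vGlue at h; omega), fun h => h ▸ rfl⟩

theorem hGlue_inj {p q p' q' : A} : K.hGlue p q = K.hGlue p' q' ↔ p = p' ∧ q = q' := by
  refine ⟨fun h => ?_, fun h => by rw [h.1, h.2]⟩
  have h' : Nat.pair (K.code p) (K.code q) = Nat.pair (K.code p') (K.code q') := by
    unfold hGlue at h; omega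
  rw [Nat.pair_eq_pair] at h'
  exact ⟨K.code_injective h'.1, K.code_injective h'.2⟩

/-- The corner of the seed. -/
def corner : TileType := ⟨3, 1, 0, 0⟩

/-- A tile of the bottom row. -/
def rowTile (a : A) (e w : ℕ) : TileType := ⟨K.vGlue a, e, 0, w⟩

/-- The tile of the leftmost column. -/
def colTile : TileType := ⟨3, K.hGlue K.b K.b, 3, 0⟩

open Classical in
/-- The tile that computes one cell of the next row. -/
noncomputable def innerTile (p q a : A) : TileType :=
  ⟨if K.H a then 4 else K.vGlue (K.g p q a), K.hGlue q a, K.vGlue a, K.hGlue p q⟩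

/-- The tile that can grow anywhere once it has started to grow. -/
def floodTile : TileType := ⟨4, 4, 4, 4⟩

/-- The tiles of the system. -/
inductive IsTile : TileType → Prop
  | corner : IsTile corner
  | row (a : A) : IsTile (K.rowTile a 1 1)
  | rowEnd (a : A) : IsTile (K.rowTile a 2 1)
  | ext : IsTile (K.rowTile K.b 2 2)
  | col : IsTile K.colTile
  | inner (p q a : A) : IsTile (K.innerTile p q a)
  | flood : IsTile floodTile

theorem finite_isTile [Finite A] : {t | K.IsTile t}.Finite := by
  refine ((((((Set.finite_singleton corner).union (Set.finite_range fun a => K.rowTile a 1 1)).union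
    (Set.finite_range fun a => K.rowTile a 2 1)).union
    (Set.finite_singleton (K.rowTile K.b 2 2))).union (Set.finite_singleton K.colTile)).union
    (Set.finite_range fun s : A × A × A => K.innerTile s.1 s.2.1 s.2.2)).union
    (Set.finite_singleton floodTile) |>.subset ?_
  rintro t (_ | _ | _ | _ | _ | ⟨p, q, a⟩ | _) <;> simp

/-- The tile of the seed at `(i, 0)`. -/
def seedTile (m i : ℕ) : TileType :=
  if i = 0 then corner else if i = 1 then K.rowTile K.u 1 1 else if i = 2 then K.rowTile K.v 1 1
  else if i < m + 3 then K.rowTile K.w 1 1 else K.rowTile K.b 2 1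

theorem isTile_seedTile (m i : ℕ) : K.IsTile (K.seedTile m i) := by
  unfold seedTile
  split_ifs <;> constructor

/-- The glue strength table. -/
def strTable : List (ℕ × ℕ) := (List.range K.bound).map fun k => (k, glueStrength k)

/-- The seed for input `m`. -/
def seedList (m : ℕ) : List ((ℤ × ℤ) × TileType) :=
  (List.range (m + 4)).map fun i : ℕ => (((i : ℤ), (0 : ℤ)), K.seedTile m i)

/-- The description of the system for input `m`. -/
noncomputable def desc [Finite A] (m : ℕ) : Desc :=
  (K.finite_isTile.toFinset, K.strTable, K.seedList m, 2)

/-- The system for input `m`. -/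
noncomputable abbrev sys [Finite A] (m : ℕ) : TAS := toTAS (K.desc m)

section System

variable [Finite A] (m : ℕ)

theorem mem_tiles {t : TileType} : t ∈ (K.sys m).tiles ↔ K.IsTile t := by
  change t ∈ K.finite_isTile.toFinset ↔ _
  simp

theorem str_of_lt {k : ℕ} (hk : k < K.bound) : (K.sys m).str k = glueStrength k := by
  change (K.strTable.lookup k).getD 0 = _
  have := lookup_map_of_injOn (List.range K.bound) id glueStrength Function.injective_id k
    (List.mem_range.2 hk)
  unfold strTable
  simp only [id] at this
  rw [this]
  rfl

theorem str_le (k : ℕ) : (K.sys m).str k ≤ glueStrength k := by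
  by_cases hk : k < K.bound
  · exact (K.str_of_lt m hk).le
  · have := lookup_map_eq_none (List.range K.bound) id glueStrength k
      fun i hi h => hk (by simpa [h] using hi)
    simp only [id] at this
    change (K.strTable.lookup k).getD 0 ≤ _
    unfold strTable
    rw [this]
    exact Nat.zero_le _

theorem str_zero : (K.sys m).str 0 = 0 := Nat.le_zero.1 (K.str_le m 0)

theorem str_le_four {k : ℕ} (h0 : k ≠ 0) (h : k ≤ 4) : (K.sys m).str k = 2 := by
  rw [str_of_lt, glueStrength, if_neg h0, if_pos h]
  exact lt_of_le_of_lt (by omega) (K.pair_lt K.b K.b)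

theorem str_vGlue (a : A) : (K.sys m).str (K.vGlue a) = 1 := by
  rw [str_of_lt, glueStrength, if_neg, if_neg]
  · unfold vGlue; omega
  · unfold vGlue; omega
  · have := K.pair_lt a a
    have := Nat.left_le_pair (K.code a) (K.code a)
    unfold vGlue; omega

theorem str_hGlue (p q : A) : (K.sys m).str (K.hGlue p q) = 1 := by
  rw [str_of_lt _ _ (show K.hGlue p q < K.bound from K.pair_lt p q), glueStrength, if_neg, if_neg]
  · unfold hGlue; omega
  · unfold hGlue; omega

theorem seed_eq (i : ℕ) (hi : i < m + 4) :
    (K.sys m).seed ((i : ℤ), 0) = some (K.seedTile m i) :=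
  lookup_map_of_injOn (List.range (m + 4)) (fun i : ℕ => ((i : ℤ), (0 : ℤ))) (K.seedTile m)
    (fun i j h => by simpa using h) i (List.mem_range.2 hi)

theorem seed_eq_none (p : ℤ × ℤ) (hp : ¬ (0 ≤ p.1 ∧ p.1 < m + 4 ∧ p.2 = 0)) :
    (K.sys m).seed p = none := by
  refine lookup_map_eq_none (List.range (m + 4)) (fun i : ℕ => ((i : ℤ), (0 : ℤ))) (K.seedTile m)
    p fun i hi h => hp ?_
  rw [List.mem_range] at hi
  subst h
  exact ⟨by simp, by dsimp only; omega, rfl⟩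

theorem seed_ne_none {p : ℤ × ℤ} :
    (K.sys m).seed p ≠ none ↔ 0 ≤ p.1 ∧ p.1 < m + 4 ∧ p.2 = 0 := by
  constructor
  · intro h
    by_contra h'
    exact h (K.seed_eq_none m p h')
  · rintro ⟨h1, h2, h3⟩
    obtain ⟨x, y⟩ := p
    dsimp only at h1 h2 h3
    subst h3
    lift x to ℕ using h1
    rw [K.seed_eq m x (by omega)]
    simp

end System

/-- The east glue of the tile of the bottom row in column `x`. -/
def rowGlue (m : ℕ) (x : ℤ) : ℕ := if x ≤ m + 2 then 1 else 2

/-- The tile that is expected at a position if the automaton does not halt before. -/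
noncomputable def expected (m : ℕ) (p : ℤ × ℤ) : Option TileType :=
  if p.1 < 0 ∨ p.2 < 0 then none
  else match p.2.toNat with
    | 0 => if p.1 = 0 then some corner
      else some (K.rowTile (K.row m 0 p.1) (rowGlue m p.1) (rowGlue m (p.1 - 1)))
    | t + 1 => if p.1 = 0 then some K.colTile
      else some (K.innerTile (K.row m t (p.1 - 2)) (K.row m t (p.1 - 1)) (K.row m t p.1))

variable (m : ℕ)

theorem expected_neg {p : ℤ × ℤ} (h : p.1 < 0 ∨ p.2 < 0) : K.expected m p = none := by
  rw [expected, if_pos h]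

theorem expected_corner : K.expected m (0, 0) = some corner := by
  simp [expected]

theorem expected_row {x : ℤ} (hx : 0 < x) : K.expected m (x, 0) =
    some (K.rowTile (K.row m 0 x) (rowGlue m x) (rowGlue m (x - 1))) := by
  have h1 : ¬ x < 0 := by omega
  have h2 : ¬ x = 0 := by omega
  simp [expected, h1, h2]

theorem expected_col (t : ℕ) : K.expected m (0, (t : ℤ) + 1) = some K.colTile := by
  have h1 : ¬ (t : ℤ) + 1 < 0 := by omega
  have h2 : ((t : ℤ) + 1).toNat = t + 1 := by omega
  simp [expected, h1, h2]

theorem expected_inner {x : ℤ} (hx : 0 < x) (t : ℕ) : K.expected m (x, (t : ℤ) + 1) =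
    some (K.innerTile (K.row m t (x - 2)) (K.row m t (x - 1)) (K.row m t x)) := by
  have h0 : ¬ (t : ℤ) + 1 < 0 := by omega
  have h3 : ((t : ℤ) + 1).toNat = t + 1 := by omega
  have h1 : ¬ x < 0 := by omega
  have h2 : ¬ x = 0 := by omega
  simp [expected, h0, h1, h2, h3]

theorem expected_seed {i : ℕ} (hi : i < m + 4) :
    K.expected m ((i : ℤ), 0) = some (K.seedTile m i) := by
  rcases Nat.eq_zero_or_pos i with rfl | h
  · exact K.expected_corner m
  · rw [K.expected_row m (by omega), seedTile, if_neg (by omega)]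
    have hr : K.row m 0 i = inputRow K.b K.u K.v K.w m i := rfl
    rw [hr, inputRow, rowGlue, rowGlue, if_pos (show (i : ℤ) - 1 ≤ m + 2 by omega)]
    by_cases h1 : i = 1
    · subst h1
      rw [if_pos (by simp), if_pos (by omega), if_pos rfl]
    rw [if_neg (by omega), if_neg h1]
    by_cases h2 : i = 2
    · subst h2
      rw [if_pos (by simp), if_pos (by omega), if_pos rfl]
    rw [if_neg (by omega), if_neg h2]
    by_cases h3 : i < m + 3
    · rw [if_pos (by omega), if_pos (by omega), if_pos h3]
    · rw [if_neg (by omega), if_neg (by omega), if_neg h3]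

theorem seed_subassembly [Finite A] : Subassembly (K.sys m).seed (K.expected m) := by
  rintro ⟨x, y⟩ t h
  obtain ⟨h1, h2, h3⟩ := (K.seed_ne_none m).1 (h ▸ Option.some_ne_none t)
  dsimp only at h1 h2 h3
  subst h3
  lift x to ℕ using h1
  rw [K.seed_eq m x (by omega)] at h
  rw [K.expected_seed m (by omega), h]

theorem isTile_of_expected {p : ℤ × ℤ} {t : TileType} (h : K.expected m p = some t) :
    K.IsTile t := by
  obtain ⟨x, y⟩ := p
  rcases lt_or_ge x 0 with hx | hx
  · rw [K.expected_neg m (Or.inl hx)] at h; cases h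
  rcases lt_or_ge y 0 with hy | hy
  · rw [K.expected_neg m (Or.inr hy)] at h; cases h
  rcases hy.eq_or_lt with rfl | hy
  · lift x to ℕ using hx
    by_cases hi : x < m + 4
    · rw [K.expected_seed m hi] at h
      cases h
      exact K.isTile_seedTile m x
    · rw [K.expected_row m (by omega), rowGlue, rowGlue, if_neg (by omega), if_neg (by omega)] at h
      have hr : K.row m 0 x = K.b := by
        change inputRow K.b K.u K.v K.w m x = K.b
        rw [inputRow, if_neg (by omega), if_neg (by omega), if_neg (by omega)]
      rw [hr] at h
      cases h
      exact .ext
  · obtain ⟨t, rfl⟩ : ∃ t : ℕ, y = t + 1 := ⟨(y - 1).toNat, by omega⟩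
    rcases hx.eq_or_lt with rfl | hx
    · rw [K.expected_col] at h; cases h; exact .col
    · rw [K.expected_inner m hx] at h; cases h; exact .inner _ _ _

theorem south_of_expected {x : ℤ} {t : TileType} (h : K.expected m (x, 0) = some t) :
    t.south = 0 := by
  rcases lt_trichotomy x 0 with hx | rfl | hx
  · rw [K.expected_neg m (Or.inl hx)] at h; cases h
  · rw [K.expected_corner] at h; cases h; rfl
  · rw [K.expected_row m hx] at h; cases h; rfl

theorem west_of_expected {y : ℤ} {t : TileType} (h : K.expected m (0, y) = some t) :
    t.west = 0 := by
  rcases lt_trichotomy y 0 with hy | rfl | hy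
  · rw [K.expected_neg m (Or.inr hy)] at h; cases h
  · rw [K.expected_corner] at h; cases h; rfl
  · obtain ⟨s, rfl⟩ : ∃ s : ℕ, y = s + 1 := ⟨(y - 1).toNat, by omega⟩
    rw [K.expected_col] at h; cases h; rfl

theorem north_of_expected_zero {y : ℤ} {t : TileType} (h : K.expected m (0, y) = some t) :
    t.north = 3 := by
  rcases lt_trichotomy y 0 with hy | rfl | hy
  · rw [K.expected_neg m (Or.inr hy)] at h; cases h
  · rw [K.expected_corner] at h; cases h; rfl
  · obtain ⟨s, rfl⟩ : ∃ s : ℕ, y = s + 1 := ⟨(y - 1).toNat, by omega⟩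
    rw [K.expected_col] at h; cases h; rfl

theorem north_of_expected {x : ℤ} (hx : 0 < x) {s : ℕ} {t : TileType}
    (hH : ∀ s', s = s' + 1 → ¬ K.H (K.row m s' x))
    (h : K.expected m (x, (s : ℤ)) = some t) : t.north = K.vGlue (K.row m s x) := by
  rcases s with _ | s
  · rw [Nat.cast_zero, K.expected_row m hx] at h; cases h; rfl
  · rw [Nat.cast_succ, K.expected_inner m hx] at h
    cases h
    exact if_neg (hH s rfl)

theorem east_of_expected {x : ℤ} (hx : 0 < x) {s : ℕ} {t : TileType}
    (h : K.expected m (x - 1, (s : ℤ) + 1) = some t) :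
    t.east = K.hGlue (K.row m s (x - 2)) (K.row m s (x - 1)) := by
  rcases (show 0 ≤ x - 1 by omega).eq_or_lt with hx' | hx'
  · obtain rfl : x = 1 := by omega
    rw [K.row_nonpos _ _ _ (by omega), K.row_nonpos _ _ _ (by omega)]
    rw [sub_self, K.expected_col] at h
    cases h; rfl
  · rw [K.expected_inner m hx'] at h
    cases h
    rw [show x - 2 = x - 1 - 1 by ring]
    rfl

theorem row_large {x : ℤ} (hx : m + 3 ≤ x) : K.row m 0 x = K.b := by
  change inputRow K.b K.u K.v K.w m x = K.b
  rw [inputRow, if_neg (by omega), if_neg (by omega), if_neg (by omega)]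

theorem eq_ext {t : TileType} (ht : K.IsTile t) (h : t.west = 2) : t = K.rowTile K.b 2 2 := by
  rcases ht with _ | _ | _ | _ | _ | ⟨p, q, a⟩ | _ <;>
    simp [corner, rowTile, colTile, innerTile, floodTile, hGlue] at h ⊢
  omega

theorem eq_col {t : TileType} (ht : K.IsTile t) (h : t.south = 3) : t = K.colTile := by
  rcases ht with _ | _ | _ | _ | _ | ⟨p, q, a⟩ | _ <;>
    simp [corner, rowTile, colTile, innerTile, floodTile, vGlue] at h ⊢
  omega

theorem eq_inner {t : TileType} (ht : K.IsTile t) {p q a : A} (hs : t.south = K.vGlue a)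
    (hw : t.west = K.hGlue p q) : t = K.innerTile p q a := by
  rcases ht with _ | _ | _ | _ | _ | ⟨p', q', a'⟩ | _
  · exact absurd hs (by simp only [corner, vGlue]; omega)
  · exact absurd hs (by simp only [rowTile, vGlue]; omega)
  · exact absurd hs (by simp only [rowTile, vGlue]; omega)
  · exact absurd hs (by simp only [rowTile, vGlue]; omega)
  · exact absurd hs (by simp only [colTile, vGlue]; omega)
  · obtain rfl := K.vGlue_inj.1 hs
    obtain ⟨rfl, rfl⟩ := K.hGlue_inj.1 hw
    rfl
  · exact absurd hs (by simp only [floodTile, vGlue]; omega)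

section Soundness

variable [Finite A]

theorem eq_of_sideStrength_pos {str : ℕ → ℕ} {g : ℕ} {o : Option ℕ}
    (h : 0 < sideStrength str g o) : o = some g ∧ 0 < str g := by
  unfold sideStrength at h
  split_ifs at h with h'
  · exact ⟨h', h⟩
  · exact absurd h (lt_irrefl 0)

theorem sideStrength_some_zero (g : ℕ) : sideStrength (K.sys m).str g (some 0) = 0 := by
  by_contra h
  obtain ⟨h1, h2⟩ := eq_of_sideStrength_pos (Nat.pos_of_ne_zero h)
  cases h1
  exact absurd (K.str_zero m) h2.ne'

theorem sideStrength_vGlue_le (g : ℕ) (a : A) :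
    sideStrength (K.sys m).str g (some (K.vGlue a)) ≤ 1 := by
  unfold sideStrength
  split_ifs with h
  · cases h
    rw [K.str_vGlue]
  · exact Nat.zero_le _

theorem sideStrength_hGlue_le (g : ℕ) (p q : A) :
    sideStrength (K.sys m).str g (some (K.hGlue p q)) ≤ 1 := by
  unfold sideStrength
  split_ifs with h
  · cases h
    rw [K.str_hGlue]
  · exact Nat.zero_le _

/-- As long as the automaton does not halt, only expected tiles can attach. -/
theorem expected_of_attach (hH : ∀ t x, ¬ K.H (K.row m t x)) {γ : Assembly}
    (hγ : Subassembly γ (K.expected m)) {x y : ℤ} (hp : (K.sys m).seed (x, y) = none)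
    (hN : 0 ≤ x → 0 ≤ y → γ (x, y + 1) = none) (hE : 0 ≤ x → 0 ≤ y → γ (x + 1, y) = none)
    {t : TileType} (ht : K.IsTile t) (h : 2 ≤ attachStrength (K.sys m).str γ (x, y) t) :
    K.expected m (x, y) = some t ∧ 0 ≤ x ∧ 0 ≤ y ∧ (0 < x → γ (x - 1, y) ≠ none) ∧
      (0 < y → γ (x, y - 1) ≠ none) := by
  have hneg : ∀ {p : ℤ × ℤ}, p.1 < 0 ∨ p.2 < 0 → γ p = none := by
    intro p hp
    by_contra h
    obtain ⟨u, hu⟩ := Option.ne_none_iff_exists'.1 h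
    have := hγ _ _ hu
    rw [K.expected_neg m hp] at this
    cases this
  rw [attachStrength_eq] at h
  rcases lt_or_ge x 0 with hx | hx
  · exfalso
    rw [hneg (p := (x, y + 1)) (Or.inl hx), hneg (p := (x, y - 1)) (Or.inl hx),
      hneg (p := (x - 1, y)) (Or.inl (show x - 1 < 0 by omega))] at h
    simp only [Option.map_none, sideStrength_none] at h
    rcases hu : γ (x + 1, y) with _ | u
    · rw [hu] at h
      simp [sideStrength_none] at h
    · have h' := hγ _ _ hu
      obtain rfl : x = -1 := by
        by_contra hne
        rw [hneg (p := (x + 1, y)) (Or.inl (show x + 1 < 0 by omega))] at hu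
        cases hu
      rw [hu, Option.map_some, K.west_of_expected m h', sideStrength_some_zero] at h
      omega
  rcases lt_or_ge y 0 with hy | hy
  · exfalso
    rw [hneg (p := (x + 1, y)) (Or.inr hy), hneg (p := (x - 1, y)) (Or.inr hy),
      hneg (p := (x, y - 1)) (Or.inr (show y - 1 < 0 by omega))] at h
    simp only [Option.map_none, sideStrength_none] at h
    rcases hu : γ (x, y + 1) with _ | u
    · rw [hu] at h
      simp [sideStrength_none] at h
    · have h' := hγ _ _ hu
      obtain rfl : y = -1 := by
        by_contra hne
        rw [hneg (p := (x, y + 1)) (Or.inr (show y + 1 < 0 by omega))] at hu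
        cases hu
      rw [hu, Option.map_some, K.south_of_expected m h', sideStrength_some_zero] at h
      omega
  rw [hN hx hy, hE hx hy] at h
  simp only [Option.map_none, sideStrength_none, zero_add] at h
  rcases hy.eq_or_lt with rfl | hy
  · have hxm : (m : ℤ) + 4 ≤ x := by
      by_contra hlt
      exact (K.seed_ne_none m).2 ⟨hx, by dsimp only; omega, rfl⟩ hp
    rw [hneg (p := (x, 0 - 1)) (Or.inr (by simp))] at h
    simp only [Option.map_none, sideStrength_none, zero_add] at h
    obtain ⟨h1, -⟩ := eq_of_sideStrength_pos (lt_of_lt_of_le Nat.two_pos h)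
    obtain ⟨u, hu, hut⟩ := Option.map_eq_some_iff.1 h1
    have h2 := hγ _ _ hu
    rw [K.expected_row m (by omega)] at h2
    have hw : t.west = 2 := by
      rw [← hut, ← Option.some.inj h2]
      exact if_neg (by omega)
    refine ⟨?_, hx, le_rfl, fun _ => by rw [hu]; simp, fun h0 => absurd h0 (lt_irrefl 0)⟩
    rw [K.expected_row m (by omega), K.row_large m (by omega), rowGlue, rowGlue,
      if_neg (by omega), if_neg (by omega), K.eq_ext ht hw]
  · obtain ⟨s, rfl⟩ : ∃ s : ℕ, y = s + 1 := ⟨(y - 1).toNat, by omega⟩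
    rw [add_sub_cancel_right] at h
    rcases hx.eq_or_lt with rfl | hx'
    · rw [hneg (p := (0 - 1, _)) (Or.inl (by simp))] at h
      simp only [Option.map_none, sideStrength_none, add_zero] at h
      obtain ⟨h1, -⟩ := eq_of_sideStrength_pos (lt_of_lt_of_le Nat.two_pos h)
      obtain ⟨u, hu, hut⟩ := Option.map_eq_some_iff.1 h1
      have h2 := K.north_of_expected_zero m (hγ _ _ hu)
      refine ⟨?_, le_rfl, hy.le, fun h0 => absurd h0 (lt_irrefl 0), fun _ => ?_⟩
      · rw [K.expected_col, K.eq_col ht (by rw [← hut, h2])]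
      · rw [add_sub_cancel_right, hu]; simp
    · have hS : sideStrength (K.sys m).str t.south ((γ (x, (s : ℤ))).map TileType.north) ≤ 1 := by
        rcases hu : γ (x, (s : ℤ)) with _ | u
        · simp [sideStrength_none]
        · rw [Option.map_some, K.north_of_expected m hx' (fun _ _ => hH _ _) (hγ _ _ hu)]
          exact K.sideStrength_vGlue_le m _ _
      have hW : sideStrength (K.sys m).str t.west
          ((γ (x - 1, (s : ℤ) + 1)).map TileType.east) ≤ 1 := by
        rcases hu : γ (x - 1, (s : ℤ) + 1) with _ | u
        · simp [sideStrength_none]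
        · rw [Option.map_some, K.east_of_expected m hx' (hγ _ _ hu)]
          exact K.sideStrength_hGlue_le m _ _ _
      obtain ⟨h1, -⟩ := eq_of_sideStrength_pos
        (show 0 < sideStrength (K.sys m).str t.south ((γ (x, (s : ℤ))).map TileType.north) by omega)
      obtain ⟨h2, -⟩ := eq_of_sideStrength_pos (show 0 < sideStrength (K.sys m).str t.west
          ((γ (x - 1, (s : ℤ) + 1)).map TileType.east) by omega)
      obtain ⟨u, hu, hut⟩ := Option.map_eq_some_iff.1 h1
      obtain ⟨u', hu', hut'⟩ := Option.map_eq_some_iff.1 h2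
      refine ⟨?_, hx, hy.le, fun _ => by rw [hu']; simp, fun _ => ?_⟩
      · rw [K.expected_inner m hx', K.eq_inner ht (by
          rw [← hut, K.north_of_expected m hx' (fun _ _ => hH _ _) (hγ _ _ hu)]) (by
          rw [← hut', K.east_of_expected m hx' (hγ _ _ hu')])]
      · rw [add_sub_cancel_right, hu]; simp

/-- The producible assemblies, as long as the automaton does not halt. -/
structure Good (α : Assembly) : Prop where
  seed : Subassembly (K.sys m).seed α
  sub : Subassembly α (K.expected m)
  left : ∀ x y, α (x, y) ≠ none → 0 < x → α (x - 1, y) ≠ none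
  down : ∀ x y, α (x, y) ≠ none → 0 < y → α (x, y - 1) ≠ none

variable {K m}

theorem Good.north {α : Assembly} (hα : K.Good m α) {x y : ℤ} (h : α (x, y) = none)
    (hy : 0 ≤ y) : α (x, y + 1) = none := by
  by_contra h'
  have := hα.down x (y + 1) h' (by omega)
  rw [add_sub_cancel_right] at this
  exact this h

theorem Good.east {α : Assembly} (hα : K.Good m α) {x y : ℤ} (h : α (x, y) = none)
    (hx : 0 ≤ x) : α (x + 1, y) = none := by
  by_contra h'
  have := hα.left (x + 1) y h' (by omega)
  rw [add_sub_cancel_right] at this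
  exact this h

theorem Good.seed_eq_none {α : Assembly} (hα : K.Good m α) {p : ℤ × ℤ} (h : α p = none) :
    (K.sys m).seed p = none := by
  by_contra h'
  obtain ⟨u, hu⟩ := Option.ne_none_iff_exists'.1 h'
  rw [hα.seed _ _ hu] at h
  cases h

theorem place_of_ne_none {α : Assembly} {p q : ℤ × ℤ} {t : TileType} (h : α q ≠ none) :
    place α p t q ≠ none := by
  unfold place
  split_ifs
  · simp
  · exact h

theorem Good.step (hH : ∀ t x, ¬ K.H (K.row m t x)) {α β : Assembly} (hα : K.Good m α)
    (h : Step (K.sys m) α β) : K.Good m β := by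
  obtain ⟨⟨x, y⟩, t, ht, hp, hs, rfl⟩ := h
  obtain ⟨h1, hx, hy, hl, hd⟩ := K.expected_of_attach m hH hα.sub (hα.seed_eq_none hp)
    (fun _ => hα.north hp) (fun hx _ => hα.east hp hx) ((K.mem_tiles m).1 ht) hs
  refine ⟨fun q u hu => ?_, fun q u hu => ?_, fun x' y' h hx' => place_of_ne_none ?_,
    fun x' y' h hy' => place_of_ne_none ?_⟩
  · have h2 := hα.seed q u hu
    unfold place
    rw [if_neg, h2]
    rintro rfl
    rw [h2] at hp
    cases hp
  · unfold place at hu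
    split_ifs at hu with hq
    · subst hq
      rw [h1, hu]
    · exact hα.sub q u hu
  · unfold place at h
    split_ifs at h with hq
    · cases hq
      exact hl hx'
    · exact hα.left _ _ h hx'
  · unfold place at h
    split_ifs at h with hq
    · cases hq
      exact hd hy'
    · exact hα.down _ _ h hy'

variable (K m)

theorem good_seed : K.Good m (K.sys m).seed := by
  refine ⟨fun _ _ h => h, K.seed_subassembly m, fun x y h hx => ?_, fun x y h hy => ?_⟩
  · obtain ⟨h1, h2, h3⟩ := (K.seed_ne_none m).1 h
    dsimp only at h1 h2 h3
    exact (K.seed_ne_none m).2 ⟨by dsimp only; omega, by dsimp only; omega, h3⟩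
  · obtain ⟨h1, h2, h3⟩ := (K.seed_ne_none m).1 h
    dsimp only at h3
    omega

theorem good_of_producible (hH : ∀ t x, ¬ K.H (K.row m t x)) {α : Assembly}
    (h : Producible (K.sys m) α) : K.Good m α := by
  obtain ⟨f, ⟨h0, hs⟩, hα⟩ := h
  have hf : ∀ n, K.Good m (f n) := by
    intro n
    induction n with
    | zero => rw [h0]; exact K.good_seed m
    | succ n ih =>
      rcases hs n with h | h
      · exact ih.step hH h
      · rwa [h]
  have hne : ∀ p, α p ≠ none ↔ ∃ n, f n p ≠ none := by
    intro p
    simp only [Option.ne_none_iff_exists', hα p]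
    exact exists_comm
  refine ⟨fun p t h => (hα p t).2 ⟨0, h0 ▸ h⟩, fun p t h => ?_, fun x y h hx => ?_,
    fun x y h hy => ?_⟩
  · obtain ⟨n, hn⟩ := (hα p t).1 h
    exact (hf n).sub p t hn
  · obtain ⟨n, hn⟩ := (hne _).1 h
    exact (hne _).2 ⟨n, (hf n).left x y hn hx⟩
  · obtain ⟨n, hn⟩ := (hne _).1 h
    exact (hne _).2 ⟨n, (hf n).down x y hn hy⟩

theorem good_of_producibleFrom (hH : ∀ t x, ¬ K.H (K.row m t x)) {α β : Assembly}
    (hα : K.Good m α) (h : ProducibleFrom (K.sys m) α β) : K.Good m β := by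
  induction h with
  | refl => exact hα
  | tail _ hs ih => exact ih.step hH hs

theorem not_seedBlocks (hH : ∀ t x, ¬ K.H (K.row m t x)) : ¬ SeedBlocks (K.sys m) := by
  rintro ⟨⟨i, j⟩, hℓ, α, hα, -, -, β, ⟨x, y⟩, u, hβ, hadj, hq, hu, hs, -⟩
  have hg := K.good_of_producibleFrom m hH (K.good_of_producible m hH hα) hβ
  obtain ⟨h1, h2, h3⟩ := (K.seed_ne_none m).1 hℓ
  dsimp only at h1 h2 h3
  subst h3
  have hu0 : ∀ {p : ℤ × ℤ}, β p = none → unplace β (i, 0) p = none := by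
    intro p hp
    unfold unplace
    split_ifs
    · rfl
    · exact hp
  have hseed := hg.seed_eq_none hq
  obtain ⟨-, hx, hy, hl, hd⟩ := K.expected_of_attach m hH (γ := unplace β (i, 0))
    (fun p t h => by
      unfold unplace at h
      split_ifs at h
      exact hg.sub p t h)
    hseed (fun _ hy => hu0 (hg.north hq hy)) (fun hx _ => hu0 (hg.east hq hx))
    ((K.mem_tiles m).1 hu) hs
  have hself : unplace β (i, 0) (i, 0) = none := if_pos rfl
  have hns : ¬ (0 ≤ x ∧ x < m + 4 ∧ y = 0) := fun h => (K.seed_ne_none m).2 h hseed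
  have hadj' : (x - i).natAbs + (y - 0).natAbs = 1 := hadj
  have hc : (x = i + 1 ∧ y = 0) ∨ (x = i ∧ y = 1) := by omega
  rcases hc with ⟨rfl, rfl⟩ | ⟨rfl, rfl⟩
  · have := hl (by omega)
    rw [add_sub_cancel_right] at this
    exact this hself
  · exact hd (by omega) hself

end Soundness

theorem expected_ne_none {x y : ℤ} (hx : 0 ≤ x) (hy : 0 ≤ y) : K.expected m (x, y) ≠ none := by
  rcases hx.eq_or_lt with rfl | hx <;> rcases hy.eq_or_lt with rfl | hy
  · simp [expected_corner]
  · obtain ⟨s, rfl⟩ : ∃ s : ℕ, y = s + 1 := ⟨(y - 1).toNat, by omega⟩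
    simp [expected_col]
  · simp [K.expected_row m hx]
  · obtain ⟨s, rfl⟩ : ∃ s : ℕ, y = s + 1 := ⟨(y - 1).toNat, by omega⟩
    simp [K.expected_inner m hx]

section Completeness

variable [Finite A]

open Classical in
/-- The part of the expected assembly in `D`. -/
noncomputable def restricted (D : ℤ × ℤ → Prop) : Assembly :=
  fun p => if D p then K.expected m p else none

theorem expected_eq_seed {x : ℤ} (h0 : 0 ≤ x) (h : x < m + 4) :
    K.expected m (x, 0) = (K.sys m).seed (x, 0) := by
  lift x to ℕ using h0
  rw [K.seed_eq m x (by omega), K.expected_seed m (by omega)]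

theorem two_le_attach {γ : Assembly} {x y : ℤ} {t : TileType} (hx : 0 ≤ x) (hy : 0 ≤ y)
    (hxy : y = 0 → m + 4 ≤ x) (ht : K.expected m (x, y) = some t)
    (hl : 0 < x → γ (x - 1, y) = K.expected m (x - 1, y))
    (hd : 0 < y → γ (x, y - 1) = K.expected m (x, y - 1))
    (hH : ∀ s : ℕ, y = s + 2 → ¬ K.H (K.row m s x)) :
    2 ≤ attachStrength (K.sys m).str γ (x, y) t := by
  rw [attachStrength_eq]
  rcases hy.eq_or_lt with rfl | hy
  · have hxm := hxy rfl
    rw [hl (by omega), K.expected_row m (by omega)]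
    rw [K.expected_row m (by omega), rowGlue, rowGlue, if_neg (by omega), if_neg (by omega)] at ht
    cases ht
    have h2 : rowGlue m (x - 1) = 2 := if_neg (by omega)
    simp only [Option.map_some, rowTile, h2, sideStrength_self]
    rw [K.str_le_four m (by omega) (by omega)]
    omega
  · obtain ⟨s, rfl⟩ : ∃ s : ℕ, y = s + 1 := ⟨(y - 1).toNat, by omega⟩
    have hd' := hd hy
    rw [add_sub_cancel_right] at hd' ⊢
    rw [hd']
    obtain ⟨u, hu⟩ := Option.ne_none_iff_exists'.1
      (K.expected_ne_none m hx (show (0 : ℤ) ≤ s by omega))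
    rw [hu, Option.map_some]
    rcases hx.eq_or_lt with rfl | hx
    · rw [K.expected_col] at ht
      cases ht
      rw [K.north_of_expected_zero m hu]
      simp only [colTile, sideStrength_self]
      rw [K.str_le_four m (by omega) (by omega)]
      omega
    · rw [K.expected_inner m hx] at ht
      cases ht
      obtain ⟨u', hu'⟩ := Option.ne_none_iff_exists'.1
        (K.expected_ne_none m (show 0 ≤ x - 1 by omega) hy.le)
      rw [hl hx, hu', Option.map_some, K.east_of_expected m hx hu',
        K.north_of_expected m hx (fun s' hs' => hH s' (by omega)) hu]
      simp only [innerTile, sideStrength_self, K.str_vGlue, K.str_hGlue]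
      omega

/-- The rows below row `Y` and the first `k` cells of row `Y`, cut off at column `X`. -/
def Grown (X Y k : ℤ) (p : ℤ × ℤ) : Prop :=
  0 ≤ p.1 ∧ p.1 ≤ X ∧ 0 ≤ p.2 ∧ (p.2 < Y ∨ p.2 = Y ∧ p.1 < k)

theorem restricted_grown_seed {X : ℤ} (hX : m + 3 ≤ X) :
    K.restricted m (Grown X 0 (m + 4)) = (K.sys m).seed := by
  funext p
  obtain ⟨x, y⟩ := p
  unfold restricted Grown
  split_ifs with h
  · dsimp only at h
    obtain rfl : y = 0 := by omega
    exact K.expected_eq_seed m h.1 (by omega)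
  · exact (K.seed_eq_none m _ fun h' => h (by dsimp only at h' ⊢; omega)).symm

theorem step_grown {X Y k : ℤ} (hk : 0 ≤ k) (hkX : k ≤ X) (hY : 0 ≤ Y) (h0 : Y = 0 → m + 4 ≤ k)
    (hH : ∀ s : ℕ, Y = s + 2 → ¬ K.H (K.row m s k)) :
    Step (K.sys m) (K.restricted m (Grown X Y k)) (K.restricted m (Grown X Y (k + 1))) := by
  obtain ⟨t, ht⟩ := Option.ne_none_iff_exists'.1 (K.expected_ne_none m hk hY)
  refine ⟨(k, Y), t, (K.mem_tiles m).2 (K.isTile_of_expected m ht), ?_,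
    K.two_le_attach m hk hY h0 ht (fun h => ?_) (fun h => ?_) hH, ?_⟩
  · exact if_neg (by simp [Grown])
  · exact if_pos (by unfold Grown; dsimp only; omega)
  · exact if_pos (by unfold Grown; dsimp only; omega)
  · funext p
    obtain ⟨x, y⟩ := p
    unfold place restricted
    by_cases hp : (x, y) = (k, Y)
    · rw [if_pos hp]
      cases hp
      rw [if_pos (by unfold Grown; dsimp only; omega), ht]
    · rw [if_neg hp]
      have : Grown X Y (k + 1) (x, y) ↔ Grown X Y k (x, y) := by
        rw [Prod.mk.injEq] at hp
        unfold Grown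
        dsimp only
        omega
      by_cases hg : Grown X Y k (x, y)
      · rw [if_pos hg, if_pos (this.2 hg)]
      · rw [if_neg hg, if_neg fun h => hg (this.1 h)]

theorem grow_row {X Y : ℤ} {k₀ k : ℤ} (hk₀ : 0 ≤ k₀) (hk : k₀ ≤ k) (hkX : k ≤ X + 1) (hY : 0 ≤ Y)
    (h0 : Y = 0 → m + 4 ≤ k₀) (hH : ∀ s : ℕ, Y = s + 2 → ∀ x, ¬ K.H (K.row m s x)) :
    ProducibleFrom (K.sys m) (K.restricted m (Grown X Y k₀)) (K.restricted m (Grown X Y k)) := by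
  induction k, hk using Int.leInduction with
  | base => exact Relation.ReflTransGen.refl
  | succ k hk ih =>
    exact (ih (by omega)).tail (K.step_grown m (by omega) (by omega) hY
      (fun h => by have := h0 h; omega) fun s hs => hH s hs k)

theorem grown_next (X Y : ℤ) : Grown X Y (X + 1) = Grown X (Y + 1) 0 := by
  funext ⟨x, y⟩
  unfold Grown
  dsimp only
  rw [eq_iff_iff]
  omega

theorem grow_rows {X : ℤ} (hX : m + 3 ≤ X) (t : ℕ) (hH : ∀ s < t, ∀ x, ¬ K.H (K.row m s x)) :
    ∀ Y ≤ t + 1, ProducibleFrom (K.sys m) (K.sys m).seed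
      (K.restricted m (Grown X (Y + 1 : ℕ) 0)) := by
  intro Y hY
  induction Y with
  | zero =>
    rw [← K.restricted_grown_seed m hX, Nat.cast_add, Nat.cast_one,
      ← grown_next X]
    exact K.grow_row m (by omega) (by omega) le_rfl le_rfl (fun _ => le_rfl)
      fun s hs => by omega
  | succ Y ih =>
    refine (ih (by omega)).trans ?_
    rw [Nat.cast_add (Y + 1) 1, Nat.cast_one, ← grown_next X]
    exact K.grow_row m le_rfl (by omega) le_rfl (by omega) (fun h => by omega)
      fun s hs => hH s (by omega)

theorem two_le_attach_flood {β : Assembly} {p q : ℤ × ℤ} {v : TileType}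
    (hq : (q = (p.1 - 1, p.2) ∧ β p = some v ∧ v.west = 4) ∨
      (q = (p.1 + 1, p.2) ∧ β p = some v ∧ v.east = 4) ∨
      (q = (p.1, p.2 + 1) ∧ β p = some v ∧ v.north = 4) ∨
      (q = (p.1, p.2 - 1) ∧ β p = some v ∧ v.south = 4)) :
    2 ≤ attachStrength (K.sys m).str β q floodTile := by
  have h4 : (K.sys m).str 4 = 2 := K.str_le_four m (by omega) le_rfl
  rcases hq with ⟨rfl, h, hv⟩ | ⟨rfl, h, hv⟩ | ⟨rfl, h, hv⟩ | ⟨rfl, h, hv⟩ <;>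
    rw [attachStrength_eq]
  · rw [sub_add_cancel, h]
    simp only [floodTile, Option.map_some, hv, sideStrength_self, h4]
    omega
  · rw [add_sub_cancel_right, h]
    simp only [floodTile, Option.map_some, hv, sideStrength_self, h4]
    omega
  · rw [add_sub_cancel_right, h]
    simp only [floodTile, Option.map_some, hv, sideStrength_self, h4]
    omega
  · rw [sub_add_cancel, h]
    simp only [floodTile, Option.map_some, hv, sideStrength_self, h4]
    omega

theorem flood_left {β : Assembly} {x y : ℤ} (hβ : ∀ z ≤ x, β (z, y) = none) {v : TileType}
    (hv : β (x, y - 1) = some v) (h4 : v.north = 4) (k : ℕ) :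
    ∃ β', ProducibleFrom (K.sys m) β β' ∧ β' (x - k, y) = some floodTile ∧
      ∀ p, β' p = β p ∨ p.2 = y ∧ x - k ≤ p.1 := by
  have place_self : ∀ (α : Assembly) p, place α p floodTile p = some floodTile :=
    fun α p => if_pos rfl
  induction k with
  | zero =>
    refine ⟨place β (x, y) floodTile, Relation.ReflTransGen.single
      ⟨(x, y), floodTile, (K.mem_tiles m).2 .flood, hβ x le_rfl, K.two_le_attach_flood m
        (p := (x, y - 1)) (Or.inr (Or.inr (Or.inl ⟨by simp, hv, h4⟩))), rfl⟩,
      by rw [Nat.cast_zero, sub_zero, place_self], fun p => ?_⟩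
    unfold place
    split_ifs with hp
    · subst hp; right; simp
    · exact Or.inl rfl
  | succ k ih =>
    obtain ⟨β', h1, h2, h3⟩ := ih
    have hn : β' (x - (k + 1 : ℕ), y) = none := by
      rcases h3 (x - (k + 1 : ℕ), y) with h | ⟨-, h⟩
      · rw [h, hβ _ (by omega)]
      · dsimp only at h; omega
    refine ⟨place β' (x - (k + 1 : ℕ), y) floodTile, h1.tail
      ⟨_, floodTile, (K.mem_tiles m).2 .flood, hn, K.two_le_attach_flood m
        (p := (x - k, y)) (Or.inl ⟨?_, h2, rfl⟩), rfl⟩, place_self _ _, fun p => ?_⟩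
    · push_cast; rw [sub_sub]
    unfold place
    split_ifs with hp
    · subst hp; right; simp
    · rcases h3 p with h | h
      · exact Or.inl h
      · exact Or.inr ⟨h.1, by omega⟩

theorem flood_down {β : Assembly} {x y : ℤ} (hv : β (x, y) = some floodTile)
    (hβ : ∀ z < y, β (x, z) = none) (k : ℕ) :
    ∃ β', ProducibleFrom (K.sys m) β β' ∧ β' (x, y - k) = some floodTile ∧
      ∀ p, β' p = β p ∨ p.1 = x ∧ y - k ≤ p.2 := by
  induction k with
  | zero => exact ⟨β, Relation.ReflTransGen.refl, by rw [Nat.cast_zero, sub_zero, hv],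
      fun p => Or.inl rfl⟩
  | succ k ih =>
    obtain ⟨β', h1, h2, h3⟩ := ih
    have hn : β' (x, y - (k + 1 : ℕ)) = none := by
      rcases h3 (x, y - (k + 1 : ℕ)) with h | ⟨-, h⟩
      · rw [h, hβ _ (by omega)]
      · dsimp only at h; omega
    refine ⟨place β' (x, y - (k + 1 : ℕ)) floodTile, h1.tail
      ⟨_, floodTile, (K.mem_tiles m).2 .flood, hn, K.two_le_attach_flood m
        (p := (x, y - k)) (Or.inr (Or.inr (Or.inr ⟨?_, h2, rfl⟩))), rfl⟩, if_pos rfl, fun p => ?_⟩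
    · push_cast; rw [sub_sub]
    unfold place
    split_ifs with hp
    · subst hp; right; simp
    · rcases h3 p with h | h
      · exact Or.inl h
      · exact Or.inr ⟨h.1, by omega⟩

theorem seedBlocks_of_halts (h : ∃ t x, K.H (K.row m t x)) : SeedBlocks (K.sys m) := by
  classical
  obtain ⟨x, hx⟩ := Nat.find_spec h
  have hmin : ∀ s < Nat.find h, ∀ x, ¬ K.H (K.row m s x) :=
    fun s hs x hsx => Nat.find_min h hs ⟨x, hsx⟩
  generalize Nat.find h = t at hx hmin
  have hx0 : 0 < x := by
    by_contra h0
    rw [K.row_nonpos m t x (by omega)] at hx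
    exact K.not_halt hx
  have hgrow := K.grow_rows m (X := max x (m + 3)) (le_max_right _ _) t hmin (t + 1) le_rfl
  set β := K.restricted m (Grown (max x (m + 3)) (t + 1 + 1 : ℕ) 0) with hβ
  have hnone : ∀ p : ℤ × ℤ, p.1 < 0 ∨ t + 2 ≤ p.2 → β p = none := by
    intro p hp
    refine if_neg fun hg => ?_
    unfold Grown at hg
    omega
  have hv : β (x, (t : ℤ) + 2 - 1) =
      some (K.innerTile (K.row m t (x - 2)) (K.row m t (x - 1)) (K.row m t x)) := by
    rw [show (t : ℤ) + 2 - 1 = t + 1 by ring, ← K.expected_inner m hx0]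
    refine if_pos ?_
    unfold Grown
    have := le_max_left x ((m : ℤ) + 3)
    dsimp only
    omega
  obtain ⟨β₁, h1, h2, h3⟩ := K.flood_left m (y := (t : ℤ) + 2)
    (fun z _ => hnone (z, _) (Or.inr le_rfl)) hv (if_pos hx) (x + 1).toNat
  have hx1 : x - ((x + 1).toNat : ℤ) = -1 := by omega
  rw [hx1] at h2 h3
  obtain ⟨β₂, h4, h5, h6⟩ := K.flood_down m h2 (fun z hz => by
    rcases h3 (-1, z) with h | ⟨h, -⟩
    · rw [h, hnone _ (Or.inl (by simp))]
    · dsimp only at h; omega) (t + 1)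
  rw [show (t : ℤ) + 2 - (t + 1 : ℕ) = 1 by push_cast; ring] at h5 h6
  have h7 : β₂ (-1, 0) = none := by
    rcases h6 (-1, 0) with h | ⟨-, h⟩
    · rw [h]
      rcases h3 (-1, 0) with h | ⟨h, -⟩
      · rw [h, hnone _ (Or.inl (by simp))]
      · dsimp only at h; omega
    · dsimp only at h; omega
  have hs0 : (K.sys m).seed (0, 0) = some corner := K.seed_eq m 0 (by omega)
  refine ⟨(0, 0), (K.seed_ne_none m).2 ⟨le_rfl, by dsimp only; omega, rfl⟩, (K.sys m).seed,
    ⟨fun _ => (K.sys m).seed, ⟨rfl, fun _ => Or.inr rfl⟩, fun p t => by simp⟩, corner, hs0,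
    β₂, (-1, 0), floodTile, (hgrow.trans h1).trans h4, by simp [Adjacent], h7,
    (K.mem_tiles m).2 .flood, K.two_le_attach_flood m (p := (-1, 1)) (v := floodTile)
      (Or.inr (Or.inr (Or.inr ⟨by simp, ?_, rfl⟩))), place β₂ (-1, 0) floodTile,
    Relation.ReflTransGen.refl, floodTile, (K.mem_tiles m).2 .flood, by simp [floodTile, corner],
    K.two_le_attach_flood m (p := (-1, 0)) (v := floodTile)
      (Or.inr (Or.inl ⟨by simp, ?_, rfl⟩))⟩
  · rw [unplace, if_neg (by simp), h5]
  · rw [unplace, if_neg (by simp), place, if_pos rfl]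

theorem exists_boundary {P : ℕ → Prop} {n a b : ℕ} (ha : a < n) (hb : b < n) (hPa : P a)
    (hPb : ¬ P b) : ∃ k, k + 1 < n ∧ ¬ (P k ↔ P (k + 1)) := by
  by_contra hne
  push Not at hne
  have : ∀ k < n, P k ↔ P 0 := by
    intro k hk
    induction k with
    | zero => rfl
    | succ k ih => exact (hne k hk).symm.trans (ih (by omega))
  exact hPb ((this b hb).2 ((this a ha).1 hPa))

theorem two_le_interaction {i : ℕ} (hi : i + 1 < m + 4) :
    2 ≤ interactionStrength (K.sys m).str (K.sys m).seed ((i : ℤ), 0) (((i + 1 : ℕ) : ℤ), 0) ∧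
    2 ≤ interactionStrength (K.sys m).str (K.sys m).seed (((i + 1 : ℕ) : ℤ), 0) ((i : ℤ), 0) := by
  have h1 := K.seed_eq m i (by omega)
  have h2 := K.seed_eq m (i + 1) hi
  have he : (K.seedTile m i).east = 1 := by
    unfold seedTile
    split_ifs <;> first | rfl | omega
  have hw : (K.seedTile m (i + 1)).west = 1 := by
    rw [seedTile, if_neg (Nat.succ_ne_zero i)]
    split_ifs <;> rfl
  have hs : (K.sys m).str 1 = 2 := K.str_le_four m (by omega) (by omega)
  unfold interactionStrength
  rw [h1, h2]
  constructor
  · dsimp only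
    rw [if_neg (by simp), if_pos (by push_cast; rfl), he, hw, if_pos rfl, hs]
  · dsimp only
    have hne : ((i : ℤ), (0 : ℤ)) ≠ (((i + 1 : ℕ) : ℤ) + 1, 0) := by
      rw [Ne, Prod.mk.injEq]
      omega
    rw [if_neg (by simp), if_neg hne, if_neg (by simp), if_pos (by push_cast; simp), he, hw,
      if_pos rfl, hs]

theorem wellFormed : WellFormed (K.sys m) := by
  refine ⟨K.str_zero m, by change 1 ≤ 2; omega, ?_, fun p t h => ?_, ?_⟩
  · refine ((Set.finite_Ico (0 : ℤ) (m + 4)).prod (Set.finite_singleton (0 : ℤ))).subset ?_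
    intro p hp
    obtain ⟨h1, h2, h3⟩ := (K.seed_ne_none m).1 hp
    exact ⟨⟨h1, h2⟩, h3⟩
  · exact (K.mem_tiles m).2 (K.isTile_of_expected m (K.seed_subassembly m p t h))
  · rintro S R hSR hdis ⟨⟨x, y⟩, hx⟩ ⟨⟨x', y'⟩, hx'⟩
    have hdom : ∀ p, (p ∈ S ∨ p ∈ R) ↔ 0 ≤ p.1 ∧ p.1 < m + 4 ∧ p.2 = 0 := by
      intro p
      rw [← K.seed_ne_none m]
      have : p ∈ (S : Set (ℤ × ℤ)) ∪ (R : Set (ℤ × ℤ)) ↔ p ∈ adom (K.sys m).seed := by rw [hSR]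
      exact this
    have hterm : ∀ p ∈ S, ∀ q ∈ R, 2 ≤ interactionStrength (K.sys m).str (K.sys m).seed p q →
        2 ≤ cutStrength (K.sys m).str (K.sys m).seed S R := fun p hp q hq h =>
      h.trans ((Finset.single_le_sum (f := fun q => interactionStrength _ _ p q)
        (fun _ _ => Nat.zero_le _) hq).trans
        (Finset.single_le_sum (f := fun p => ∑ q ∈ R, interactionStrength _ _ p q)
        (fun _ _ => Nat.zero_le _) hp))
    obtain ⟨h1, h2, h3⟩ := (hdom _).1 (Or.inl hx)
    obtain ⟨h1', h2', h3'⟩ := (hdom _).1 (Or.inr hx')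
    dsimp only at h1 h2 h3 h1' h2' h3'
    subst h3 h3'
    lift x to ℕ using h1
    lift x' to ℕ using h1'
    obtain ⟨k, hk, hne⟩ := exists_boundary (P := fun k : ℕ => ((k : ℤ), (0 : ℤ)) ∈ S)
      (n := m + 4) (by omega) (by omega) hx (fun h => Finset.disjoint_left.1 hdis h hx')
    have hor : ∀ i < m + 4, ((i : ℤ), (0 : ℤ)) ∈ S ∨ ((i : ℤ), (0 : ℤ)) ∈ R := fun i hi =>
      (hdom _).2 ⟨by simp, by dsimp only; omega, rfl⟩
    obtain ⟨hi1, hi2⟩ := K.two_le_interaction m hk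
    by_cases hkS : ((k : ℤ), (0 : ℤ)) ∈ S
    · have hn : ¬ (((k + 1 : ℕ) : ℤ), (0 : ℤ)) ∈ S := fun h => hne ⟨fun _ => h, fun _ => hkS⟩
      exact hterm _ hkS _ ((hor (k + 1) hk).resolve_left hn) hi1
    · have hn : (((k + 1 : ℕ) : ℤ), (0 : ℤ)) ∈ S := by
        by_contra h
        exact hne ⟨fun h' => absurd h' hkS, fun h' => absurd h' h⟩
      exact hterm _ hn _ ((hor k (by omega)).resolve_left hkS) hi2

end Completeness

section Computability

theorem encode_map_encode {α : Type} [Encodable α] (l : List α) :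
    Encodable.encode (l.map Encodable.encode) = Encodable.encode l := by
  induction l with
  | nil => rfl
  | cons a l ih =>
    rw [List.map_cons, Encodable.encode_list_cons, Encodable.encode_list_cons, ih]
    rfl

theorem primrec_encode_seedTile : Primrec₂ fun m i => Encodable.encode (K.seedTile m i) := by
  have : (fun p : ℕ × ℕ => Encodable.encode (K.seedTile p.1 p.2)) = fun p : ℕ × ℕ =>
      if p.2 = 0 then Encodable.encode corner
      else if p.2 = 1 then Encodable.encode (K.rowTile K.u 1 1)
      else if p.2 = 2 then Encodable.encode (K.rowTile K.v 1 1)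
      else if p.2 < p.1 + 3 then Encodable.encode (K.rowTile K.w 1 1)
      else Encodable.encode (K.rowTile K.b 2 1) := by
    funext p
    unfold seedTile
    split_ifs <;> rfl
  change Primrec fun p : ℕ × ℕ => Encodable.encode (K.seedTile p.1 p.2)
  rw [this]
  have heq : ∀ n, PrimrecPred fun p : ℕ × ℕ => p.2 = n := fun n =>
    Primrec.eq.comp Primrec.snd (Primrec.const n)
  exact Primrec.ite (heq 0) (Primrec.const _) (Primrec.ite (heq 1) (Primrec.const _)
    (Primrec.ite (heq 2) (Primrec.const _) (Primrec.ite
      (Primrec.nat_lt.comp Primrec.snd (Primrec.nat_add.comp Primrec.fst (Primrec.const 3)))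
      (Primrec.const _) (Primrec.const _))))

theorem primrec_encode_seedList : Primrec fun m => Encodable.encode (K.seedList m) := by
  have : (fun m => Encodable.encode (K.seedList m)) = fun m => Encodable.encode
      ((List.range (m + 4)).map fun i => Nat.pair
        (Nat.pair (2 * i) (Encodable.encode (0 : ℤ))) (Encodable.encode (K.seedTile m i))) := by
    funext m
    rw [← encode_map_encode, seedList, List.map_map]
    rfl
  rw [this]
  refine Primrec.encode.comp (Primrec.list_map
    (Primrec.list_range.comp (Primrec.nat_add.comp Primrec.id (Primrec.const 4))) ?_)
  exact Primrec₂.natPair.comp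
    (Primrec₂.natPair.comp (Primrec.nat_mul.comp (Primrec.const 2) Primrec.snd) (Primrec.const _))
    K.primrec_encode_seedTile

theorem primrec_encode_desc [Finite A] : Primrec fun m => Encodable.encode (K.desc m) :=
  Primrec₂.natPair.comp (Primrec.const (Encodable.encode K.finite_isTile.toFinset))
    (Primrec₂.natPair.comp (Primrec.const (Encodable.encode K.strTable))
      (Primrec₂.natPair.comp K.primrec_encode_seedList (Primrec.const (Encodable.encode 2))))

end Computability

/-- The blocking systems of `K` many-one reduce the halting problem for `K`. -/
theorem computablePred_halts [Finite A]
    (h : ComputablePred fun n : ℕ => ∃ d : Desc, (Encodable.decode n : Option Desc) = some d ∧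
      WellFormed (toTAS d) ∧ SeedBlocks (toTAS d)) :
    ComputablePred fun m : ℕ => ∃ t x, K.H (K.row m t x) := by
  refine ComputablePred.computable_of_manyOneReducible
    ⟨fun m => Encodable.encode (K.desc m), K.primrec_encode_desc.to_comp, fun m => ?_⟩ h
  constructor
  · exact fun hm => ⟨K.desc m, Encodable.encodek _, K.wellFormed m, K.seedBlocks_of_halts m hm⟩
  · rintro ⟨d, hd, -, hs⟩
    rw [Encodable.encodek] at hd
    cases hd
    by_contra hm
    push Not at hm
    exact K.not_seedBlocks m hm hs

end CellAutomaton

end Tiles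

/-- **Uncomputability of blocking** (Observation 1): it is undecidable, given
(an encoding of) an arbitrary aTAM system, whether some location of its seed
assembly can block a tile in one or more valid assembly sequences. -/
theorem blocking_uncomputable :
    ¬ ComputablePred (fun n : ℕ =>
      ∃ d : Desc, (Encodable.decode n : Option Desc) = some d ∧
        WellFormed (toTAS d) ∧ SeedBlocks (toTAS d)) := by
  obtain ⟨A, _, b, u, v, w, g, H, hg, hb, h⟩ := exists_undecidable_automaton
  intro hc
  obtain ⟨code, hcode⟩ := Countable.exists_injective_nat A
  obtain ⟨N, hN⟩ := (Set.finite_range fun s : A × A =>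
    6 + 2 * Nat.pair (code s.1) (code s.2)).bddAbove
  exact h (CellAutomaton.computablePred_halts
    { b := b, u := u, v := v, w := w, g := g, H := H, code := code, bound := N + 1,
      quiescent := hg, not_halt := hb, code_injective := hcode,
      pair_lt := fun p q => Nat.lt_succ_of_le (hN ⟨(p, q), rfl⟩) } hc)


end ATAM
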